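/- arXiv:2603.15446 — 8 statements merged into one kernel-verified Lean document; each statement's English description precedes it below -/
import Mathlib

section
/- Every continuous character χ of ℤ_p with values in C takes values in the open unit disk around 1: for every x ∈ ℤ_p one has ‖χ(x) − 1‖ < 1. -/
/-- Every continuous character `χ` of `ℤ_p` with values in `C`
(a complete, nontrivially normed, ultrametric field which is a normed `ℚ_p`-algebra)
takes values in the open unit disk around `1`: `‖χ x − 1‖ < 1` for every `x : ℤ_p`. -/
theorem continuous_character_padicInt_mem_unit_disk
    {p : ℕ} [Fact p.Prime] {C : Type*} [NontriviallyNormedField C]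
    [CompleteSpace C] [IsUltrametricDist C] [NormedAlgebra ℚ_[p] C]
    (χ : ℤ_[p] → Cˣ) (hχ : ∀ x y : ℤ_[p], χ (x + y) = χ x * χ y)
    (hcont : Continuous fun x : ℤ_[p] => (χ x : C)) (x : ℤ_[p]) :
    ‖(χ x : C) - 1‖ < 1 := by
  let _ : Algebra ℤ_[p] C := Algebra.compHom C (algebraMap ℤ_[p] ℚ_[p])
  have hsmul (r : ℤ_[p]) (c : C) : r • c = (r : ℚ_[p]) • c := rfl
  have : IsBoundedSMul ℤ_[p] C := .of_norm_smul_le fun r c => by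
    rw [hsmul, norm_smul, PadicInt.norm_def]
  have hzero : χ 0 = 1 := by simpa using hχ 0 0
  let κ : AddChar ℤ_[p] C :=
    { toFun := fun z => (χ (x * z) : C)
      map_zero_eq_one' := by simp [hzero]
      map_add_eq_mul' := fun a b => by simp [mul_add, hχ] }
  have hκ : Continuous κ := hcont.comp (continuous_const_mul x)
  have hκ_one : κ 1 = (χ x : C) := congrArg (fun z => (χ z : C)) (mul_one x)
  rw [← hκ_one]
  exact tendsto_pow_atTop_nhds_zero_iff_norm_lt_one.mp (κ.tendsto_eval_one_sub_pow hκ)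
end

section
/- The evaluation map χ ↦ χ(1) is a bijection from the set of continuous characters of ℤ_p with values in C onto the open disk {z ∈ C : ‖z − 1‖ < 1}. Moreover, if χ is a continuous character with z = χ(1), then for every x ∈ ℤ_p the binomial series converges and computes χ: χ(x) = ∑_{n=0}^∞ binom(x, n)·(z − 1)^n, where binom(x, n) := (1/n!)·∏_{i=0}^{n−1}(x − i) ∈ ℤ_p is regarded in C via the algebra map. -/
/-- The set of continuous characters of `ℤ_p` with values in `C`: group homomorphisms
`χ` from the additive group `ℤ_p` to `Cˣ` such that `x ↦ (χ x : C)` is continuous. -/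
def PadicContChar (p : ℕ) [Fact p.Prime] (C : Type*) [NontriviallyNormedField C] : Type _ :=
  {χ : ℤ_[p] → Cˣ // (∀ x y : ℤ_[p], χ (x + y) = χ x * χ y) ∧
      Continuous fun x : ℤ_[p] => (χ x : C)}

/-- The binomial coefficient `binom(x, n) = (1/n!) · ∏_{i=0}^{n-1} (x - i)`, computed in
`ℚ_p` (it actually lies in `ℤ_p`). -/
noncomputable def padicBinom {p : ℕ} [Fact p.Prime] (x : ℤ_[p]) (n : ℕ) : ℚ_[p] :=
  ((n.factorial : ℚ_[p]))⁻¹ * ∏ i ∈ Finset.range n, ((x : ℚ_[p]) - (i : ℚ_[p]))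

theorem descPochhammer_smeval_eq_prod_range {R : Type*} [CommRing R] (r : R) (n : ℕ) :
    (descPochhammer ℤ n).smeval r = ∏ i ∈ Finset.range n, (r - i) := by
  induction n with
  | zero => simp [Polynomial.smeval_one]
  | succ n ih =>
    simp [descPochhammer_succ_right, Polynomial.smeval_mul, Polynomial.smeval_sub,
      Polynomial.smeval_natCast, ih, Finset.prod_range_succ]

theorem padicBinom_eq_choose {p : ℕ} [Fact p.Prime] (x : ℤ_[p]) (n : ℕ) :
    padicBinom x n = ((Ring.choose x n : ℤ_[p]) : ℚ_[p]) := by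
  have h := Ring.descPochhammer_eq_factorial_smul_choose x n
  rw [descPochhammer_smeval_eq_prod_range, nsmul_eq_mul] at h
  have h' := congrArg (PadicInt.Coe.ringHom (p := p)) h
  simp only [map_prod, map_sub, map_mul, map_natCast] at h'
  exact (congrArg ((n.factorial : ℚ_[p])⁻¹ * ·) h').trans
    (inv_mul_cancel_left₀ (mod_cast n.factorial_ne_zero) _)

namespace PadicContChar

variable {p : ℕ} [Fact p.Prime] {C : Type*} [NontriviallyNormedField C]

/-- The continuous character `χ`, regarded as an additive character with values in `C`. -/
noncomputable def toAddChar (χ : PadicContChar p C) : AddChar ℤ_[p] C where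
  toFun x := χ.1 x
  map_zero_eq_one' := by
    have h := χ.2.1 0 0
    rw [add_zero, left_eq_mul] at h
    simp [h]
  map_add_eq_mul' x y := by rw [χ.2.1, Units.val_mul]

theorem toAddChar_apply (χ : PadicContChar p C) (x : ℤ_[p]) : χ.toAddChar x = χ.1 x := rfl

theorem continuous_toAddChar (χ : PadicContChar p C) : Continuous χ.toAddChar := χ.2.2

theorem toAddChar_injective :
    Function.Injective (toAddChar : PadicContChar p C → AddChar ℤ_[p] C) := by
  intro χ ψ h
  refine Subtype.ext (funext fun x => Units.ext ?_)
  exact DFunLike.congr_fun h x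

/-- A continuous additive character with values in `C`, regarded as a character with values in
`Cˣ`. -/
noncomputable def ofAddChar (κ : AddChar ℤ_[p] C) (hκ : Continuous κ) : PadicContChar p C :=
  ⟨fun x => ⟨κ x, κ (-x), by rw [← κ.map_add_eq_mul, add_neg_cancel, κ.map_zero_eq_one],
      by rw [← κ.map_add_eq_mul, neg_add_cancel, κ.map_zero_eq_one]⟩,
    fun x y => Units.ext (κ.map_add_eq_mul x y), hκ⟩

end PadicContChar

/-- The evaluation map `χ ↦ χ 1` is a bijection from the set of continuous
characters of `ℤ_p` with values in `C` onto the open disk `{z : C | ‖z − 1‖ < 1}`; the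
binomial coefficients `binom(x, n)` lie in `ℤ_p` (their `p`-adic norm is `≤ 1`); and for
every continuous character `χ` with `z = χ 1`, and every `x : ℤ_p`, the binomial series
`∑_{n} binom(x, n)·(z − 1)^n` converges to `χ x` (the coefficients being regarded in `C`
via the algebra map). -/
theorem padic_character_binomial_series
    (p : ℕ) [Fact p.Prime] (C : Type*) [NontriviallyNormedField C]
    [CompleteSpace C] [IsUltrametricDist C] [NormedAlgebra ℚ_[p] C] :
    Function.Injective (fun χ : PadicContChar p C => (χ.1 1 : C)) ∧
    Set.range (fun χ : PadicContChar p C => (χ.1 1 : C)) = {z : C | ‖z - 1‖ < 1} ∧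
    (∀ (x : ℤ_[p]) (n : ℕ), ‖padicBinom x n‖ ≤ 1) ∧
    (∀ χ : PadicContChar p C, ∀ x : ℤ_[p],
      HasSum (fun n : ℕ =>
          algebraMap ℚ_[p] C (padicBinom x n) * ((χ.1 1 : C) - 1) ^ n) (χ.1 x : C)) := by
  let _ : Algebra ℤ_[p] C := Algebra.compHom C (PadicInt.Coe.ringHom (p := p))
  have smul_eq (a : ℤ_[p]) (c : C) : a • c = algebraMap ℚ_[p] C a * c := Algebra.smul_def _ _
  have : IsBoundedSMul ℤ_[p] C := .of_norm_smul_le fun a c => by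
    rw [smul_eq, norm_mul, norm_algebraMap', PadicInt.norm_def]
  have tendsto_pow (χ : PadicContChar p C) :
      Filter.Tendsto (((χ.1 1 : C) - 1) ^ ·) Filter.atTop (nhds 0) :=
    χ.toAddChar.tendsto_eval_one_sub_pow χ.continuous_toAddChar
  have eq_mahler (χ : PadicContChar p C) : χ.toAddChar =
      PadicInt.addChar_of_value_at_one ((χ.1 1 : C) - 1) (tendsto_pow χ) :=
    PadicInt.eq_addChar_of_value_at_one _ χ.continuous_toAddChar
      (by rw [χ.toAddChar_apply, add_sub_cancel])
  refine ⟨fun χ ψ h => ?_, ?_, fun x n => ?_, fun χ x => ?_⟩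
  · apply PadicContChar.toAddChar_injective
    simp only [eq_mahler]
    congr 2
  · ext z
    constructor
    · rintro ⟨χ, rfl⟩
      exact tendsto_pow_atTop_nhds_zero_iff_norm_lt_one.mp (tendsto_pow χ)
    · intro hz
      have hr := tendsto_pow_atTop_nhds_zero_iff_norm_lt_one.mpr hz
      refine ⟨.ofAddChar _ (PadicInt.continuous_addChar_of_value_at_one (p := p) hr), ?_⟩
      exact (PadicInt.addChar_of_value_at_one_def hr).trans (add_sub_cancel _ _)
  · rw [padicBinom_eq_choose]
    exact PadicInt.norm_le_one _
  · have h := ContinuousMap.hasSum_apply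
      (PadicInt.hasSum_mahlerSeries (p := p) (tendsto_pow χ)) x
    rw [← PadicInt.coe_addChar_of_value_at_one (tendsto_pow χ), ← eq_mahler] at h
    simpa only [PadicInt.mahlerTerm_apply, smul_eq, mahler_apply, padicBinom_eq_choose,
      χ.toAddChar_apply] using h
end

section
/- Let r be a natural number and let T = ℤ_p^r (r-tuples of p-adic integers) with standard basis vectors e_1, …, e_r. The map χ ↦ (χ(e_1), …, χ(e_r)) is a bijection from the set of continuous group homomorphisms from the additive group T to Cˣ (continuous as maps T → C) onto the set of r-tuples (z_1, …, z_r) ∈ C^r with ‖z_i − 1‖ < 1 for every i. (This identifies the group of C-valued locally ℚ_p-analytic characters of a free ℤ_p-module of rank r with an r-fold product of open unit disks around 1.) -/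
/-- The set of continuous characters of `T = ℤ_p^r` with values in `C`: group homomorphisms
from the additive group `T` to `Cˣ` which are continuous as maps `T → C`. -/
def PadicRankContChar (p : ℕ) [Fact p.Prime] (r : ℕ) (C : Type*)
    [NontriviallyNormedField C] : Type _ :=
  {χ : (Fin r → ℤ_[p]) → Cˣ //
      (∀ x y : Fin r → ℤ_[p], χ (x + y) = χ x * χ y) ∧
      Continuous fun x : Fin r → ℤ_[p] => (χ x : C)}

section RankOne

variable {p : ℕ} [Fact p.Prime] {C : Type*} [NontriviallyNormedField C]
  [NormedAlgebra ℚ_[p] C]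

variable (p C) in
/-- A normed `ℚ_p`-algebra is a `ℤ_p`-algebra by restriction of scalars. -/
noncomputable abbrev padicIntAlgebra : Algebra ℤ_[p] C :=
  Algebra.compHom C (algebraMap ℤ_[p] ℚ_[p])

lemma isBoundedSMul_padicIntAlgebra :
    letI := padicIntAlgebra p C
    IsBoundedSMul ℤ_[p] C := by
  let := padicIntAlgebra p C
  refine IsBoundedSMul.of_norm_smul_le fun a x => ?_
  change ‖(a : ℚ_[p]) • x‖ ≤ _
  rw [norm_smul, PadicInt.norm_def]

variable [IsUltrametricDist C]

lemma AddChar.norm_eval_one_sub_one_lt_one {κ : AddChar ℤ_[p] C} (hκ : Continuous κ) :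
    ‖κ 1 - 1‖ < 1 := by
  let := padicIntAlgebra p C
  have := isBoundedSMul_padicIntAlgebra (p := p) (C := C)
  exact tendsto_pow_atTop_nhds_zero_iff_norm_lt_one.mp (κ.tendsto_eval_one_sub_pow hκ)

lemma exists_continuous_addChar_eval_one_eq [CompleteSpace C] {z : C} (hz : ‖z - 1‖ < 1) :
    ∃ κ : AddChar ℤ_[p] C, Continuous κ ∧ κ 1 = z := by
  let := padicIntAlgebra p C
  have := isBoundedSMul_padicIntAlgebra (p := p) (C := C)
  have h := tendsto_pow_atTop_nhds_zero_iff_norm_lt_one.mpr hz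
  refine ⟨PadicInt.addChar_of_value_at_one (z - 1) h,
    PadicInt.continuous_addChar_of_value_at_one h, ?_⟩
  simp [PadicInt.addChar_of_value_at_one_def h]

end RankOne

namespace PadicRankContChar

variable {p : ℕ} [Fact p.Prime] {r : ℕ} {C : Type*} [NontriviallyNormedField C]

/-- The restriction of a character of `ℤ_p^r` to the `i`-th coordinate axis. -/
noncomputable def restrictCoord (χ : PadicRankContChar p r C) (i : Fin r) : AddChar ℤ_[p] C where
  toFun t := (χ.1 (Pi.single i t) : C)
  map_zero_eq_one' := by
    have h := χ.2.1 0 0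
    rw [add_zero, left_eq_mul] at h
    rw [Pi.single_zero, h, Units.val_one]
  map_add_eq_mul' a b := by rw [Pi.single_add, χ.2.1, Units.val_mul]

lemma continuous_restrictCoord (χ : PadicRankContChar p r C) (i : Fin r) :
    Continuous (χ.restrictCoord i) :=
  χ.2.2.comp (continuous_single (A := fun _ => ℤ_[p]) i)

lemma apply_eq_prod_restrictCoord (χ : PadicRankContChar p r C) (x : Fin r → ℤ_[p]) :
    (χ.1 x : C) = ∏ i, χ.restrictCoord i (x i) := by
  let φ : Multiplicative (Fin r → ℤ_[p]) →* Cˣ :=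
    MonoidHom.mk' (fun y => χ.1 y.toAdd) fun a b => χ.2.1 a.toAdd b.toAdd
  have h : χ.1 x = ∏ i, χ.1 (Pi.single i (x i)) := by
    conv_lhs => rw [← Finset.univ_sum_single x]
    exact (congrArg φ (ofAdd_sum Finset.univ fun i => Pi.single i (x i))).trans
      (map_prod φ _ _)
  rw [h, Units.coe_prod]
  rfl

/-- The product of continuous characters of the coordinate axes, as a character of `ℤ_p^r`. -/
noncomputable def ofCoord (κ : Fin r → AddChar ℤ_[p] C) (hκ : ∀ i, Continuous (κ i)) :
    PadicRankContChar p r C :=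
  ⟨fun x => ∏ i, Units.mk0 (κ i (x i)) ((κ i).val_isUnit (x i)).ne_zero, fun x y => by
    rw [← Finset.prod_mul_distrib]
    refine Finset.prod_congr rfl fun i _ => Units.ext ?_
    simp [AddChar.map_add_eq_mul], by
    simp only [Units.coe_prod, Units.val_mk0]
    exact continuous_finsetProd _ fun i _ => (hκ i).comp (continuous_apply i)⟩

lemma ofCoord_single (κ : Fin r → AddChar ℤ_[p] C) (hκ : ∀ i, Continuous (κ i))
    (i : Fin r) (t : ℤ_[p]) : ((ofCoord κ hκ).1 (Pi.single i t) : C) = κ i t := by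
  simp only [ofCoord, Units.coe_prod, Units.val_mk0]
  rw [Finset.prod_eq_single i (fun j _ hj => by simp [Pi.single_eq_of_ne hj]) (by simp),
    Pi.single_eq_same]

end PadicRankContChar

/-- For `T = ℤ_p^r` with standard basis vectors `e_1, …, e_r`, the map
`χ ↦ (χ e_1, …, χ e_r)` is a bijection from the set of continuous characters of `T` with
values in `C` onto the `r`-fold product of open unit disks around `1`, i.e. the set of
tuples `(z_1, …, z_r)` with `‖z_i − 1‖ < 1` for all `i`. -/
theorem padic_free_module_character_bijection
    (p : ℕ) [Fact p.Prime] (r : ℕ) (C : Type*) [NontriviallyNormedField C]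
    [CompleteSpace C] [IsUltrametricDist C] [NormedAlgebra ℚ_[p] C] :
    Function.Injective
      (fun χ : PadicRankContChar p r C => fun i : Fin r => (χ.1 (Pi.single i 1) : C)) ∧
    Set.range (fun χ : PadicRankContChar p r C => fun i : Fin r => (χ.1 (Pi.single i 1) : C))
      = {z : Fin r → C | ∀ i : Fin r, ‖z i - 1‖ < 1} := by
  refine ⟨fun χ ψ h => ?_, Set.Subset.antisymm ?_ fun z hz => ?_⟩
  · have hcoord (i : Fin r) : χ.restrictCoord i = ψ.restrictCoord i :=
      PadicInt.denseRange_natCast.addChar_eq_of_eval_one_eq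
        (χ.continuous_restrictCoord i) (ψ.continuous_restrictCoord i) (congrFun h i)
    refine Subtype.ext (funext fun x => Units.ext ?_)
    simp only [PadicRankContChar.apply_eq_prod_restrictCoord, hcoord]
  · rintro _ ⟨χ, rfl⟩ i
    exact AddChar.norm_eval_one_sub_one_lt_one (χ.continuous_restrictCoord i)
  · choose κ hκ hκz using fun i => exists_continuous_addChar_eval_one_eq (p := p) (hz i)
    exact ⟨.ofCoord κ hκ, funext fun i =>
      (PadicRankContChar.ofCoord_single κ hκ i 1).trans (hκz i)⟩
end

section
/- Let q and k be natural numbers with q > 0 and q coprime to p. Then the set of images in ℤ_p of positive natural numbers m with m ≡ k (mod q) is dense in ℤ_p. -/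
/-- Let `q, k : ℕ` with `q > 0` and `q` coprime to `p`. Then the set of
images in `ℤ_p` of positive natural numbers `m` with `m ≡ k (mod q)` is dense in `ℤ_p`. -/
theorem dense_image_nat_congruent_padicInt
    (p : ℕ) [Fact p.Prime] (q k : ℕ) (hq : 0 < q) (hqp : Nat.Coprime q p) :
    Dense ((fun m : ℕ => (m : ℤ_[p])) '' {m : ℕ | 0 < m ∧ m ≡ k [MOD q]}) := by
  have hp : p.Prime := Fact.out
  rw [Metric.dense_iff]
  intro x ε hε
  obtain ⟨n, hn⟩ := PadicInt.exists_pow_neg_lt p hε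
  -- The Chinese remainder theorem gives `c ≡ k (mod q)` approximating `x` modulo `p ^ n`;
  -- adding `q * p ^ n` makes it positive.
  obtain ⟨c, hck, hcx⟩ := Nat.chineseRemainder (hqp.pow_right n) k (x.appr n)
  refine ⟨((c + q * p ^ n : ℕ) : ℤ_[p]), ?_, c + q * p ^ n, ⟨?_, ?_⟩, rfl⟩
  · have hmod : x.appr n ≡ c + q * p ^ n [MOD p ^ n] := by
      simpa [Nat.ModEq] using hcx.symm
    obtain ⟨d, hd⟩ := hmod.dvd
    have hd' : ((c + q * p ^ n : ℕ) : ℤ_[p]) - x.appr n = (p : ℤ_[p]) ^ n * d := by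
      exact_mod_cast congrArg (Int.cast : ℤ → ℤ_[p]) hd
    have hmem : ((c + q * p ^ n : ℕ) : ℤ_[p]) - x ∈ Ideal.span {(p : ℤ_[p]) ^ n} := by
      rw [← sub_sub_sub_cancel_right _ _ (x.appr n : ℤ_[p]), hd']
      exact sub_mem (Ideal.mul_mem_right _ _ (Ideal.mem_span_singleton_self _))
        (PadicInt.appr_spec n x)
    rw [Metric.mem_ball, dist_eq_norm]
    exact ((PadicInt.norm_le_pow_iff_mem_span_pow _ n).mpr hmem).trans_lt hn
  · have := Nat.mul_pos hq (pow_pos hp.pos n)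
    omega
  · simpa [Nat.ModEq] using hck
end

section
/- Let Λ ⊆ Λ' be nonzero fractional ideals of L (so the quotient Λ'/Λ is finite), let t ∈ L, s ∈ ℂ, and let Γ ≤ O_L^× be a subgroup with γ^α = 1 for all γ ∈ Γ and (γ − 1)·x ∈ Λ for all γ ∈ Γ and all x ∈ t + Λ'. For u ∈ L with (γ−1)·x ∈ M for x ∈ u+M, write E^{0,α}(u, s, M, Γ) for the sum over the Γ-orbits of (u + M) ∖ {0} of λ ↦ λ^{−α}·N(λ)^{−s} (these sets are Γ-stable and the summand is constant on Γ-orbits). Assume the function defining E^{0,α}(t, s, Λ', Γ) is summable on the Γ-orbits of (t + Λ') ∖ {0}. Then, for any set R ⊆ Λ' of representatives of Λ'/Λ, one has the distribution relation ∑_{s₀ ∈ R} E^{0,α}(t + s₀, s, Λ, Γ) = E^{0,α}(t, s, Λ', Γ). -/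
open NumberField
open scoped nonZeroDivisors

noncomputable section

variable (L : Type*) [Field L] [NumberField L]

/-- The setoid on a subset `S` of `L` induced by the multiplication action of a subgroup
`Γ ≤ 𝓞(L)ˣ`: two elements of `S` are related iff they lie in the same `Γ`-orbit. -/
def unitOrbitSetoid (Γ : Subgroup ((𝓞 L)ˣ)) (S : Set L) : Setoid S :=
  Setoid.comap Subtype.val (MulAction.orbitRel Γ L)

/-- The induced function on the set of `Γ`-orbits of `S` (evaluated via a choice of orbit
representatives) is (unconditionally) summable. -/
def OrbitSummable (Γ : Subgroup ((𝓞 L)ˣ)) (S : Set L) (g : L → ℂ) : Prop :=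
  Summable fun q : Quotient (unitOrbitSetoid L Γ S) => g (q.out : L)

/-- The unconditional sum, over the set of `Γ`-orbits of `S`, of the function induced by
`g` (evaluated via a choice of orbit representatives). -/
def orbitSum (Γ : Subgroup ((𝓞 L)ˣ)) (S : Set L) (g : L → ℂ) : ℂ :=
  ∑' q : Quotient (unitOrbitSetoid L Γ S), g (q.out : L)

/-- The Eisenstein summand `λ ↦ λ^{−α}·N(λ)^{−s}`, where `λ^α = ∏_{σ ∈ Σ} σ(λ)^{α σ}`
and `N(λ)^{−s}` is the complex power of the positive rational `N(λ) = Norm_{L/ℚ}(λ)`. -/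
def eisSummand (Sig : Finset (L →+* ℂ)) (α : (L →+* ℂ) → ℕ) (s : ℂ) (lam : L) : ℂ :=
  (∏ σ ∈ Sig, σ lam ^ α σ)⁻¹ * ((Algebra.norm ℚ lam : ℂ) ^ (-s))

section

variable {L}

lemma Subgroup.smul_eq_algebraMap_mul {K : Type*} [Field K] {Γ : Subgroup (𝓞 K)ˣ}
    (γ : Γ) (x : K) : γ • x = algebraMap (𝓞 K) K (γ : (𝓞 K)ˣ) * x := by
  rw [Subgroup.smul_def, Units.smul_def, Algebra.smul_def]

open scoped Classical in
open InfinitePlace ComplexEmbedding in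
/-- In a field without real embeddings, norms to `ℚ` are nonnegative. -/
lemma norm_eq_abs_norm_of_isEmpty_real [IsEmpty (L →+* ℝ)] (x : L) :
    Algebra.norm ℚ x = |Algebra.norm ℚ x| := by
  have fiber (w : InfinitePlace L) :
      ∏ φ : L →+* ℂ with mk φ = w, φ x = ((w x ^ mult w : ℝ) : ℂ) := by
    have hw : ¬ IsReal w := fun h ↦ isEmptyElim (embedding_of_isReal h)
    have hset : ({φ | mk φ = w} : Finset (L →+* ℂ)) =
        {embedding w, conjugate (embedding w)} := by
      ext φ
      rw [Finset.mem_filter_univ, ← mk_embedding w, mk_eq_iff, conjugate,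
        star_involutive.eq_iff, mk_embedding]
      simp [conjugate]
    have hne : embedding w ≠ conjugate (embedding w) := by
      rwa [Ne, eq_comm, ← ComplexEmbedding.isReal_iff, ← InfinitePlace.isReal_iff]
    rw [hset, Finset.prod_pair hne, conjugate_coe_eq, Complex.mul_conj, mult, if_neg hw,
      Complex.normSq_eq_norm_sq, norm_embedding_eq]
  have h : ((Algebra.norm ℚ x : ℚ) : ℂ) = ((|Algebra.norm ℚ x| : ℚ) : ℂ) := by
    calc ((Algebra.norm ℚ x : ℚ) : ℂ) = ∏ φ : L →+* ℂ, φ x := by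
          rw [← eq_ratCast (algebraMap ℚ ℂ), Algebra.norm_eq_prod_embeddings ℚ ℂ x]
          exact (Fintype.prod_equiv (RingHom.equivRatAlgHom L ℂ) _ _ fun _ ↦ by
            simp [RingHom.equivRatAlgHom_apply]).symm
      _ = ∏ w : InfinitePlace L, ((w x ^ mult w : ℝ) : ℂ) := by
          rw [← Finset.prod_fiberwise Finset.univ mk]
          exact Finset.prod_congr rfl fun w _ ↦ fiber w
      _ = ((|Algebra.norm ℚ x| : ℚ) : ℂ) := by
          rw [← Complex.ofReal_prod, prod_eq_abs_norm, Complex.ofReal_ratCast]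
  exact_mod_cast h

lemma norm_unit_eq_one_of_isEmpty_real [IsEmpty (L →+* ℝ)] (γ : (𝓞 L)ˣ) :
    Algebra.norm ℚ (algebraMap (𝓞 L) L (γ : 𝓞 L)) = 1 := by
  rw [norm_eq_abs_norm_of_isEmpty_real]
  exact NumberField.isUnit_iff_norm.mp γ.isUnit

lemma eisSummand_unit_mul [IsEmpty (L →+* ℝ)] {Sig : Finset (L →+* ℂ)} {α : (L →+* ℂ) → ℕ}
    {γ : (𝓞 L)ˣ} (hγ : (∏ σ ∈ Sig, σ (algebraMap (𝓞 L) L (γ : 𝓞 L)) ^ α σ) = 1)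
    (s : ℂ) (x : L) :
    eisSummand L Sig α s (algebraMap (𝓞 L) L (γ : 𝓞 L) * x) = eisSummand L Sig α s x := by
  simp only [eisSummand, map_mul, mul_pow, Finset.prod_mul_distrib, hγ,
    norm_unit_eq_one_of_isEmpty_real, one_mul]

/-- If `S` is covered by finitely many subsets `T r` such that no `Γ`-orbit meets two of them,
then the orbit sum over `S` is the sum of the orbit sums over the `T r`. -/
lemma sum_orbitSum_eq_orbitSum {K ι : Type*} [Field K] {Γ : Subgroup (𝓞 K)ˣ}
    {R : Finset ι} {S : Set K} {T : ι → Set K} {g : K → ℂ}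
    (hTS : ∀ r ∈ R, T r ⊆ S) (hcover : ∀ x ∈ S, ∃ r ∈ R, x ∈ T r)
    (hsep : ∀ r ∈ R, ∀ r' ∈ R, ∀ γ : Γ, ∀ x ∈ T r, γ • x ∈ T r' → r = r')
    (hg : ∀ (γ : Γ) (x : K), g (γ • x) = g x) (hsum : OrbitSummable K Γ S g) :
    ∑ r ∈ R, orbitSum K Γ (T r) g = orbitSum K Γ S g := by
  let F (p : Σ r : R, Quotient (unitOrbitSetoid K Γ (T r))) :
      Quotient (unitOrbitSetoid K Γ S) :=
    Quotient.map (Set.inclusion (hTS p.1 p.1.2)) (fun _ _ h ↦ h) p.2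
  have hF : Function.Bijective F := by
    constructor
    · rintro ⟨⟨r, hr⟩, ⟨x⟩⟩ ⟨⟨r', hr'⟩, ⟨y⟩⟩ h
      obtain ⟨γ, hγ : γ • (y : K) = x⟩ := Quotient.exact h
      obtain rfl := hsep r' hr' r hr γ y y.2 (hγ ▸ x.2)
      exact congrArg _ (Quotient.sound ⟨γ, hγ⟩)
    · rintro ⟨x⟩
      obtain ⟨r, hr, hx⟩ := hcover x x.2
      exact ⟨⟨⟨r, hr⟩, Quotient.mk _ ⟨x, hx⟩⟩, rfl⟩
  have hgF (p) : g ((F p).out : K) = g (p.2.out : K) := by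
    have h : F p = Quotient.mk _ (Set.inclusion (hTS p.1 p.1.2) p.2.out) := by
      conv_lhs => rw [← Sigma.eta p, ← Quotient.out_eq p.2]
      rfl
    obtain ⟨γ, hγ : γ • (p.2.out : K) = (F p).out⟩ :=
      Quotient.exact ((Quotient.out_eq (F p)).trans h)
    rw [← hγ, hg]
  have hsum' : Summable fun p : Σ r : R, Quotient (unitOrbitSetoid K Γ (T r)) ↦
      g (p.2.out : K) := by
    simpa only [Function.comp_def, Equiv.ofBijective_apply, hgF] using
      (Equiv.ofBijective F hF).summable_iff.mpr hsum
  calc ∑ r ∈ R, orbitSum K Γ (T r) g = ∑ r : R, orbitSum K Γ (T r) g :=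
        (Finset.sum_coe_sort R _).symm
    _ = ∑' p : Σ r : R, Quotient (unitOrbitSetoid K Γ (T r)), g (p.2.out : K) := by
        rw [hsum'.tsum_sigma, tsum_fintype]
        rfl
    _ = orbitSum K Γ S g := by
        rw [orbitSum, ← (Equiv.ofBijective F hF).tsum_eq]
        exact tsum_congr fun p ↦ (hgF p).symm

end

/-- distribution relation. Let `Λ ⊆ Λ'` be nonzero fractional ideals of
the totally imaginary field `L`, `t ∈ L`, `s ∈ ℂ`, and `Γ ≤ 𝓞(L)ˣ` with `γ^α = 1` and
`(γ − 1)·x ∈ Λ` for all `γ ∈ Γ` and `x ∈ t + Λ'`. If `λ ↦ λ^{−α} N(λ)^{−s}` is summable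
on the `Γ`-orbits of `(t + Λ') ∖ {0}`, then for any set `R ⊆ Λ'` of representatives of
`Λ'/Λ` one has `∑_{s₀ ∈ R} E^{0,α}(t + s₀, s, Λ, Γ) = E^{0,α}(t, s, Λ', Γ)`. -/
theorem eisenstein_distribution_relation
    (L : Type*) [Field L] [NumberField L] [IsEmpty (L →+* ℝ)]
    (Λ Λ' : FractionalIdeal (𝓞 L)⁰ L) (hΛ : Λ ≠ 0) (hΛ' : Λ' ≠ 0) (hsub : Λ ≤ Λ')
    (t : L) (s : ℂ) (Γ : Subgroup ((𝓞 L)ˣ))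
    (Sig : Finset (L →+* ℂ)) (α : (L →+* ℂ) → ℕ)
    (hΓα : ∀ γ ∈ Γ, (∏ σ ∈ Sig, σ (algebraMap (𝓞 L) L (γ : 𝓞 L)) ^ α σ) = 1)
    (hΓΛ : ∀ γ ∈ Γ, ∀ x : L, x - t ∈ Λ' →
      ((algebraMap (𝓞 L) L (γ : 𝓞 L)) - 1) * x ∈ Λ)
    (R : Finset L)
    (hRmem : ∀ r ∈ R, r ∈ Λ')
    (hRrep : ∀ x : L, x ∈ Λ' → ∃ r ∈ R, x - r ∈ Λ)
    (hRdisj : ∀ r ∈ R, ∀ r' ∈ R, r - r' ∈ Λ → r = r')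
    (hsum : OrbitSummable L Γ {x : L | x - t ∈ Λ' ∧ x ≠ 0} (eisSummand L Sig α s)) :
    ∑ s₀ ∈ R, orbitSum L Γ {x : L | x - (t + s₀) ∈ Λ ∧ x ≠ 0} (eisSummand L Sig α s)
      = orbitSum L Γ {x : L | x - t ∈ Λ' ∧ x ≠ 0} (eisSummand L Sig α s) := by
  refine sum_orbitSum_eq_orbitSum ?_ ?_ ?_ (fun γ x ↦ ?_) hsum
  · rintro r hr x ⟨hx, hx0⟩
    refine ⟨?_, hx0⟩
    simpa [← sub_sub] using add_mem (S := Submodule (𝓞 L) L) (hsub hx) (hRmem r hr)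
  · rintro x ⟨hx, hx0⟩
    obtain ⟨r, hr, h⟩ := hRrep _ hx
    exact ⟨r, hr, by rwa [← sub_sub], hx0⟩
  · rintro r hr r' hr' γ x ⟨hx, -⟩ ⟨hy, -⟩
    have hxt : x - t ∈ Λ' := by
      simpa [← sub_sub] using add_mem (S := Submodule (𝓞 L) L) (hsub hx) (hRmem r hr)
    rw [Subgroup.smul_eq_algebraMap_mul] at hy
    refine hRdisj r hr r' hr' ?_
    have h := sub_mem (S := Submodule (𝓞 L) L) (sub_mem (S := Submodule (𝓞 L) L) hy hx)
      (hΓΛ γ γ.2 x hxt)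
    rw [← FractionalIdeal.mem_coe]
    convert h using 1
    ring
  · rw [Subgroup.smul_eq_algebraMap_mul, eisSummand_unit_mul (hΓα γ γ.2)]

end
end

section
/- Let b ⊆ O_L be a nonzero ideal coprime to f. Then: (1) for every λ ∈ L^× with λ − 1 ∈ f·b^{−1}, the fractional ideal λ·b is a nonzero integral ideal of O_L coprime to f; (2) the set {λ ∈ L^× : λ − 1 ∈ f·b^{−1}} is stable under multiplication by O_f^×; and (3) the assignment λ ↦ λ·b induces a bijection from the set of O_f^×-orbits of {λ ∈ L^× : λ − 1 ∈ f·b^{−1}} onto the set of nonzero integral ideals a of O_L such that a = (λ)·b for some λ ∈ L^× with λ − 1 ∈ f·b^{−1}. -/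
open NumberField FractionalIdeal
open scoped nonZeroDivisors

noncomputable section

variable (L : Type*) [Field L] [NumberField L]

/-- The group `O_f^× = {u ∈ O_L^× : u − 1 ∈ f}` of units of `𝓞 L` congruent to `1`
modulo the ideal `f`. -/
def unitsCongOne (f : Ideal (𝓞 L)) : Subgroup ((𝓞 L)ˣ) where
  carrier := {u : (𝓞 L)ˣ | (u : 𝓞 L) - 1 ∈ f}
  one_mem' := by simp
  mul_mem' := by
    intro a b ha hb
    have h : ((a * b : (𝓞 L)ˣ) : 𝓞 L) - 1
        = (a : 𝓞 L) * ((b : 𝓞 L) - 1) + ((a : 𝓞 L) - 1) := by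
      push_cast; ring
    show ((a * b : (𝓞 L)ˣ) : 𝓞 L) - 1 ∈ f
    rw [h]
    exact add_mem (Ideal.mul_mem_left _ _ hb) ha
  inv_mem' := by
    intro a ha
    have h : ((a⁻¹ : (𝓞 L)ˣ) : 𝓞 L) - 1
        = -(((a⁻¹ : (𝓞 L)ˣ) : 𝓞 L) * ((a : 𝓞 L) - 1)) := by
      rw [mul_sub, Units.inv_mul]; ring
    show ((a⁻¹ : (𝓞 L)ˣ) : 𝓞 L) - 1 ∈ f
    rw [h]
    exact neg_mem (Ideal.mul_mem_left _ _ ha)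

/-- An integer lies in an integral ideal iff it lies in the associated fractional ideal. -/
theorem algebraMap_mem_coeIdeal_iff {L : Type*} [Field L] [NumberField L]
    {a : Ideal (𝓞 L)} {x : 𝓞 L} :
    algebraMap (𝓞 L) L x ∈ (a : FractionalIdeal (𝓞 L)⁰ L) ↔ x ∈ a := by
  rw [mem_coeIdeal]
  exact (FaithfulSMul.algebraMap_injective (𝓞 L) L).mem_set_image (s := (a : Set (𝓞 L)))

/-- An element lies in `f·b⁻¹` iff it multiplies `b` into `f`. -/
theorem mem_coeIdeal_mul_inv_iff {L : Type*} [Field L] [NumberField L]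
    (f b : Ideal (𝓞 L)) (hb0 : b ≠ 0) (x : L) :
    x ∈ ((f : FractionalIdeal (𝓞 L)⁰ L) * (b : FractionalIdeal (𝓞 L)⁰ L)⁻¹) ↔
      ∀ y ∈ b, ∃ z ∈ f, algebraMap (𝓞 L) L z = x * algebraMap (𝓞 L) L y := by
  rw [← div_eq_mul_inv, mem_div_iff_of_ne_zero (coeIdeal_ne_zero.mpr hb0)]
  constructor
  · intro h y hy
    exact (mem_coeIdeal _).mp (h _ (mem_coeIdeal_of_mem _ hy))
  · intro h y hy
    obtain ⟨t, ht, rfl⟩ := (mem_coeIdeal _).mp hy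
    exact (mem_coeIdeal _).mpr (h t ht)

/-- If `λ ≠ 0` and `λ - 1 ∈ f·b⁻¹` with `b` coprime to `f`, then `λ·b` is a nonzero integral ideal
coprime to `f`. -/
theorem exists_coprime_ideal_eq_spanSingleton_mul {L : Type*} [Field L] [NumberField L]
    (f b : Ideal (𝓞 L)) (hb0 : b ≠ 0) (hbf : b ⊔ f = ⊤) (x : L) (hx0 : x ≠ 0)
    (hx : x - 1 ∈ ((f : FractionalIdeal (𝓞 L)⁰ L) * (b : FractionalIdeal (𝓞 L)⁰ L)⁻¹)) :
    ∃ a : Ideal (𝓞 L), a ≠ 0 ∧ a ⊔ f = ⊤ ∧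
      (a : FractionalIdeal (𝓞 L)⁰ L) =
        spanSingleton (𝓞 L)⁰ x * (b : FractionalIdeal (𝓞 L)⁰ L) := by
  rw [mem_coeIdeal_mul_inv_iff f b hb0] at hx
  have hle : spanSingleton (𝓞 L)⁰ x * (b : FractionalIdeal (𝓞 L)⁰ L) ≤ 1 := by
    rw [spanSingleton_mul_le_iff]
    intro y hy
    obtain ⟨t, ht, rfl⟩ := (mem_coeIdeal _).mp hy
    obtain ⟨z, -, hz⟩ := hx t ht
    exact (mem_one_iff _).mpr ⟨t + z, by rw [map_add, hz]; ring⟩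
  obtain ⟨a, ha⟩ := le_one_iff_exists_coeIdeal.mp hle
  refine ⟨a, ?_, ?_, ha⟩
  · rintro rfl
    have h : spanSingleton (𝓞 L)⁰ x * (b : FractionalIdeal (𝓞 L)⁰ L) ≠ 0 :=
      mul_ne_zero (spanSingleton_ne_zero_iff.mpr hx0) (coeIdeal_ne_zero.mpr hb0)
    exact h (by rw [← ha]; simp)
  · rw [Ideal.eq_top_iff_one] at hbf ⊢
    obtain ⟨y, hy, z, hz, hyz⟩ := Submodule.mem_sup.mp hbf
    obtain ⟨w, hw, hwe⟩ := hx y hy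
    have hmem : y + w ∈ a := by
      rw [← algebraMap_mem_coeIdeal_iff (L := L), ha]
      refine mem_singleton_mul.mpr ⟨_, mem_coeIdeal_of_mem _ hy, ?_⟩
      rw [map_add, hwe]; ring
    exact Submodule.mem_sup.mpr ⟨y + w, hmem, z - w, sub_mem hz hw, by rw [← hyz]; ring⟩

/-- Multiplication by a unit does not change a principal fractional ideal. -/
theorem spanSingleton_unit_mul {L : Type*} [Field L] [NumberField L] (u : (𝓞 L)ˣ) (x : L) :
    spanSingleton (𝓞 L)⁰ (algebraMap (𝓞 L) L u * x) = spanSingleton (𝓞 L)⁰ x := by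
  rw [← coeToSubmodule_inj, coe_spanSingleton, coe_spanSingleton, eq_comm,
    Submodule.span_singleton_eq_span_singleton]
  exact ⟨u, by rw [Units.smul_def, Algebra.smul_def]⟩

/-- Elements congruent to `1` modulo `f·b⁻¹` that generate the same ideal differ by a unit congruent
to `1` modulo `f`. -/
theorem exists_unitsCongOne_mul_eq {L : Type*} [Field L] [NumberField L]
    (f b : Ideal (𝓞 L)) (hb0 : b ≠ 0) (hbf : b ⊔ f = ⊤) (x y : L) (hy0 : y ≠ 0)
    (hx : x - 1 ∈ ((f : FractionalIdeal (𝓞 L)⁰ L) * (b : FractionalIdeal (𝓞 L)⁰ L)⁻¹))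
    (hy : y - 1 ∈ ((f : FractionalIdeal (𝓞 L)⁰ L) * (b : FractionalIdeal (𝓞 L)⁰ L)⁻¹))
    (hxy : spanSingleton (𝓞 L)⁰ x * (b : FractionalIdeal (𝓞 L)⁰ L) =
      spanSingleton (𝓞 L)⁰ y * (b : FractionalIdeal (𝓞 L)⁰ L)) :
    ∃ u ∈ unitsCongOne L f, algebraMap (𝓞 L) L (u : 𝓞 L) * y = x := by
  have hspan := mul_right_cancel₀ (coeIdeal_ne_zero.mpr hb0) hxy
  rw [← coeToSubmodule_inj, coe_spanSingleton, coe_spanSingleton, eq_comm,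
    Submodule.span_singleton_eq_span_singleton] at hspan
  obtain ⟨u, rfl⟩ := hspan
  rw [Units.smul_def, Algebra.smul_def] at hx ⊢
  refine ⟨u, ?_, rfl⟩
  obtain ⟨a, -, haf, ha⟩ := exists_coprime_ideal_eq_spanSingleton_mul f b hb0 hbf y hy0 hy
  rw [mem_coeIdeal_mul_inv_iff f b hb0] at hx hy
  rw [Ideal.eq_top_iff_one] at haf
  obtain ⟨p, hp, q, hq, hpq⟩ := Submodule.mem_sup.mp haf
  rw [← algebraMap_mem_coeIdeal_iff (L := L), ha] at hp
  obtain ⟨t₀, ht₀, hpt⟩ := mem_singleton_mul.mp hp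
  obtain ⟨t, ht, rfl⟩ := (mem_coeIdeal _).mp ht₀
  obtain ⟨v, hv, hve⟩ := hx t ht
  obtain ⟨w, hw, hwe⟩ := hy t ht
  have hmul : ((u : 𝓞 L) - 1) * p = v - w := by
    apply FaithfulSMul.algebraMap_injective (𝓞 L) L
    rw [map_mul, map_sub, map_sub, map_one, hpt, hve, hwe]
    ring
  have hu : (u : 𝓞 L) - 1 = (v - w) + ((u : 𝓞 L) - 1) * q := by
    rw [← hmul, ← mul_add, hpq, mul_one]
  change (u : 𝓞 L) - 1 ∈ f
  rw [hu]
  exact add_mem (sub_mem hv hw) (Ideal.mul_mem_left _ _ hq)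

/-- The set of `x` with `x - 1 ∈ f·b⁻¹` is stable under the units congruent to `1` modulo `f`. -/
theorem unit_mul_sub_one_mem {L : Type*} [Field L] [NumberField L]
    (f b : Ideal (𝓞 L)) (hb0 : b ≠ 0) (u : (𝓞 L)ˣ) (hu : u ∈ unitsCongOne L f) (x : L)
    (hx : x - 1 ∈ ((f : FractionalIdeal (𝓞 L)⁰ L) * (b : FractionalIdeal (𝓞 L)⁰ L)⁻¹)) :
    algebraMap (𝓞 L) L (u : 𝓞 L) * x - 1 ∈
      ((f : FractionalIdeal (𝓞 L)⁰ L) * (b : FractionalIdeal (𝓞 L)⁰ L)⁻¹) := by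
  rw [mem_coeIdeal_mul_inv_iff f b hb0] at hx ⊢
  intro y hy
  obtain ⟨z, hz, hze⟩ := hx y hy
  refine ⟨u * z + y * ((u : 𝓞 L) - 1),
    add_mem (Ideal.mul_mem_left _ _ hz) (Ideal.mul_mem_left _ _ hu), ?_⟩
  rw [map_add, map_mul, map_mul, map_sub, map_one, hze]
  ring

/-- Let `L` be a totally imaginary number field, `f ⊆ O_L` a nonzero
proper ideal and `b ⊆ O_L` a nonzero ideal coprime to `f`. Then:
(1) for every `λ ∈ L^×` with `λ − 1 ∈ f·b⁻¹`, the fractional ideal `λ·b` is a nonzero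
integral ideal coprime to `f`;
(2) the set `{λ ∈ L^× : λ − 1 ∈ f·b⁻¹}` is stable under multiplication by `O_f^×`; and
(3) `λ ↦ λ·b` induces a bijection from the set of `O_f^×`-orbits of this set onto the set
of nonzero integral ideals `a` with `a = (λ)·b` for some `λ ∈ L^×`, `λ − 1 ∈ f·b⁻¹`. -/
theorem orbit_ideal_bijection
    (L : Type*) [Field L] [NumberField L] [IsEmpty (L →+* ℝ)]
    (f : Ideal (𝓞 L)) (hf0 : f ≠ 0) (hftop : f ≠ ⊤)
    (b : Ideal (𝓞 L)) (hb0 : b ≠ 0) (hbf : b ⊔ f = ⊤) :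
    (∀ lam : L, lam ≠ 0 →
        lam - 1 ∈ ((f : FractionalIdeal (𝓞 L)⁰ L) * (b : FractionalIdeal (𝓞 L)⁰ L)⁻¹) →
        ∃ a : Ideal (𝓞 L), a ≠ 0 ∧ a ⊔ f = ⊤ ∧
          (a : FractionalIdeal (𝓞 L)⁰ L) = spanSingleton (𝓞 L)⁰ lam * (b : FractionalIdeal (𝓞 L)⁰ L)) ∧
    (∀ u ∈ unitsCongOne L f, ∀ lam ∈ {x : L | x ≠ 0 ∧
        x - 1 ∈ ((f : FractionalIdeal (𝓞 L)⁰ L) * (b : FractionalIdeal (𝓞 L)⁰ L)⁻¹)},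
      (algebraMap (𝓞 L) L (u : 𝓞 L)) * lam ∈ {x : L | x ≠ 0 ∧
        x - 1 ∈ ((f : FractionalIdeal (𝓞 L)⁰ L) * (b : FractionalIdeal (𝓞 L)⁰ L)⁻¹)}) ∧
    (∃ F : Quotient (unitOrbitSetoid L (unitsCongOne L f)
          {x : L | x ≠ 0 ∧
            x - 1 ∈ ((f : FractionalIdeal (𝓞 L)⁰ L) * (b : FractionalIdeal (𝓞 L)⁰ L)⁻¹)})
        → Ideal (𝓞 L),
      (∀ lam : {x : L | x ≠ 0 ∧
          x - 1 ∈ ((f : FractionalIdeal (𝓞 L)⁰ L) * (b : FractionalIdeal (𝓞 L)⁰ L)⁻¹)},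
        (F (Quotient.mk _ lam) : FractionalIdeal (𝓞 L)⁰ L)
          = spanSingleton (𝓞 L)⁰ (lam : L) * (b : FractionalIdeal (𝓞 L)⁰ L)) ∧
      Function.Injective F ∧
      Set.range F = {a : Ideal (𝓞 L) | a ≠ 0 ∧ ∃ lam : L, lam ≠ 0 ∧
        lam - 1 ∈ ((f : FractionalIdeal (𝓞 L)⁰ L) * (b : FractionalIdeal (𝓞 L)⁰ L)⁻¹) ∧
        (a : FractionalIdeal (𝓞 L)⁰ L)
          = spanSingleton (𝓞 L)⁰ lam * (b : FractionalIdeal (𝓞 L)⁰ L)}) := by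
  have key := exists_coprime_ideal_eq_spanSingleton_mul f b hb0 hbf
  refine ⟨key, ?_, ?_⟩
  · rintro u hu x ⟨hx0, hx⟩
    exact ⟨mul_ne_zero (by simp) hx0, unit_mul_sub_one_mem f b hb0 u hu x hx⟩
  · choose G hG0 hGf hG using key
    refine ⟨Quotient.lift (fun x => G x.1 x.2.1 x.2.2) ?_, fun x => hG x.1 x.2.1 x.2.2, ?_, ?_⟩
    · rintro ⟨x, hx0, hx⟩ ⟨y, hy0, hy⟩ ⟨u, hu⟩
      change algebraMap (𝓞 L) L ((u : (𝓞 L)ˣ) : 𝓞 L) * y = x at hu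
      rw [← coeIdeal_inj (K := L), hG, hG]
      change spanSingleton (𝓞 L)⁰ x * _ = spanSingleton (𝓞 L)⁰ y * _
      rw [← hu, spanSingleton_unit_mul]
    · rintro ⟨x, hx0, hx⟩ ⟨y, hy0, hy⟩ hxy
      change G x hx0 hx = G y hy0 hy at hxy
      rw [← coeIdeal_inj (K := L), hG, hG] at hxy
      obtain ⟨u, hu, hux⟩ := exists_unitsCongOne_mul_eq f b hb0 hbf x y hy0 hx hy hxy
      exact Quotient.sound ⟨⟨u, hu⟩, hux⟩
    · ext a
      constructor
      · rintro ⟨⟨x, hx0, hx⟩, rfl⟩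
        exact ⟨hG0 x hx0 hx, x, hx0, hx, hG x hx0 hx⟩
      · rintro ⟨-, x, hx0, hx, ha⟩
        refine ⟨Quotient.mk _ ⟨x, hx0, hx⟩, ?_⟩
        change G x hx0 hx = a
        rw [← coeIdeal_inj (K := L), hG, ha]

end
end

section
/- Every continuous character χ of ℤ_p with values in C is locally ℚ_p-analytic: there exists n ∈ ℕ such that for every a ∈ ℤ_p there is a sequence of coefficients c : ℕ → C with the property that for every y ∈ ℤ_p, the series ∑_{k=0}^∞ c_k · (ι(p^n·y))^k converges (HasSum) to χ(a + p^n·y), where ι denotes the algebra map from ℚ_p to C applied to the image of p^n·y in ℚ_p. -/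
open Filter Topology Polynomial

/-- The norm of `k!` in `ℚ_[p]` is at least `p⁻¹ ^ k`. -/
lemma Padic.pow_neg_le_norm_factorial (p : ℕ) [Fact p.Prime] (k : ℕ) :
    (p : ℝ)⁻¹ ^ k ≤ ‖(k.factorial : ℚ_[p])‖ := by
  have hp : (1 : ℝ) ≤ p := by exact_mod_cast (Fact.out : p.Prime).one_lt.le
  rw [Padic.norm_eq_zpow_neg_valuation (by exact_mod_cast k.factorial_ne_zero),
    Padic.valuation_natCast, inv_pow, ← zpow_natCast, ← zpow_neg]
  exact zpow_le_zpow_right₀ hp (by simpa using padicValNat_factorial_le (p := p) k)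

/-- The binomial coefficient `y choose k` as a polynomial in `y`. -/
lemma PadicInt.algebraMap_choose {p : ℕ} [Fact p.Prime] {C : Type*} [Field C] [Algebra ℚ_[p] C]
    (y : ℤ_[p]) (k : ℕ) :
    algebraMap ℚ_[p] C (Ring.choose y k : ℤ_[p]) =
      ∑ j ∈ Finset.range (k + 1), ((descPochhammer ℤ k).coeff j : C) / (k.factorial : C) *
        algebraMap ℚ_[p] C y ^ j := by
  have : CharZero C := Algebra.charZero_of_charZero ℚ_[p] C
  have hk : (k.factorial : C) ≠ 0 := by exact_mod_cast k.factorial_ne_zero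
  have h := congrArg (fun z : ℤ_[p] => algebraMap ℚ_[p] C z)
    (Ring.descPochhammer_eq_factorial_smul_choose y k)
  rw [← aeval_eq_smeval, aeval_eq_sum_range, descPochhammer_natDegree] at h
  simp only [nsmul_eq_mul, zsmul_eq_mul, PadicInt.coe_mul, PadicInt.coe_sum, PadicInt.coe_pow,
    PadicInt.coe_natCast, PadicInt.coe_intCast, map_mul, map_sum, map_pow, map_natCast,
    map_intCast] at h
  rw [eq_comm, ← mul_right_inj' hk, ← h, Finset.mul_sum]
  refine Finset.sum_congr rfl fun j _ => ?_
  field_simp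

/-- Exchange of the order of summation in a summable double series. -/
lemma Summable.hasSum_tsum_swap {ι ι' E : Type*} [AddCommGroup E] [UniformSpace E]
    [IsUniformAddGroup E] [CompleteSpace E] [T2Space E] {f : ι → ι' → E} {g : ι → E} {a : E}
    (hf : Summable fun x : ι × ι' => f x.1 x.2) (hrow : ∀ i, HasSum (f i) (g i))
    (hg : HasSum g a) : HasSum (fun j => ∑' i, f i j) a := by
  have htotal : ∑' x : ι × ι', f x.1 x.2 = a := (hf.hasSum.prod_fiberwise hrow).unique hg
  have hswap : HasSum (fun x : ι' × ι => f x.2 x.1) a := by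
    rw [← htotal]
    exact (Equiv.prodComm ι' ι).hasSum_iff (f := fun x => f x.1 x.2) |>.mpr hf.hasSum
  exact hswap.prod_fiberwise fun j => (hswap.summable.prod_factor j).hasSum

section

variable {p : ℕ} [Fact p.Prime] {C : Type*} [NontriviallyNormedField C]
  [CompleteSpace C] [IsUltrametricDist C] [NormedAlgebra ℚ_[p] C]

/-- The Mahler expansion of a continuous additive character. -/
lemma AddChar.hasSum_choose_mul_pow {κ : AddChar ℤ_[p] C} (hκ : Continuous κ) (y : ℤ_[p]) :
    HasSum (fun k : ℕ => algebraMap ℚ_[p] C (Ring.choose y k : ℤ_[p]) * (κ 1 - 1) ^ k) (κ y) := by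
  let _ : Algebra ℤ_[p] C := ((algebraMap ℚ_[p] C).comp PadicInt.Coe.ringHom).toAlgebra
  have hsmul (a : ℤ_[p]) (x : C) : a • x = algebraMap ℚ_[p] C a * x := rfl
  have hnorm (a : ℤ_[p]) (x : C) : ‖a • x‖ = ‖a‖ * ‖x‖ := by
    rw [hsmul, norm_mul, norm_algebraMap', PadicInt.norm_def]
  have : NormSMulClass ℤ_[p] C := ⟨hnorm⟩
  have h := ContinuousMap.hasSum_apply (PadicInt.hasSum_mahler (⟨κ, hκ⟩ : C(ℤ_[p], C))) y
  simpa only [PadicInt.mahlerTerm_apply, mahler_apply, hsmul, ContinuousMap.coe_mk,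
    fwdDiff_addChar_eq, AddChar.map_zero_eq_one, mul_one] using h

/-- If `r` is small, the coefficients of the polynomials `(y choose k) * r ^ k` decay
geometrically. -/
lemma norm_descPochhammer_coeff_div_factorial_mul_pow_le (p : ℕ) [Fact p.Prime] {C : Type*}
    [NormedField C] [IsUltrametricDist C] [NormedAlgebra ℚ_[p] C] {r : C}
    (hr : ‖r‖ ≤ (p : ℝ)⁻¹ ^ 3) (k j : ℕ) :
    ‖((descPochhammer ℤ k).coeff j : C) / (k.factorial : C) * r ^ k‖ ≤
      (p : ℝ)⁻¹ ^ k * (p : ℝ)⁻¹ ^ j := by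
  rcases lt_or_ge k j with hkj | hkj
  · rw [coeff_eq_zero_of_natDegree_lt (by rwa [descPochhammer_natDegree]), Int.cast_zero, zero_div,
      zero_mul, norm_zero]
    positivity
  have hp : (1 : ℝ) < p := by exact_mod_cast (Fact.out : p.Prime).one_lt
  generalize hq : (p : ℝ)⁻¹ = q at hr ⊢
  have hq0 : 0 < q := by rw [← hq]; positivity
  have hq1 : q < 1 := hq ▸ inv_lt_one_of_one_lt₀ hp
  have hfac : q ^ k ≤ ‖(k.factorial : C)‖ := by
    rw [← hq, ← map_natCast (algebraMap ℚ_[p] C), norm_algebraMap']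
    exact Padic.pow_neg_le_norm_factorial p k
  rw [norm_mul, norm_div, norm_pow]
  calc ‖((descPochhammer ℤ k).coeff j : C)‖ / ‖(k.factorial : C)‖ * ‖r‖ ^ k
      ≤ 1 / q ^ k * (q ^ 3) ^ k := by
        gcongr
        exact IsUltrametricDist.norm_intCast_le_one C _
    _ = q ^ k * q ^ k := by
        field_simp
        ring
    _ ≤ q ^ k * q ^ j := by
        gcongr q ^ k * ?_
        exact pow_le_pow_of_le_one hq0.le hq1.le hkj

/-- A continuous character whose value at `1` is close to `1` is given by a power series
converging on all of `ℤ_[p]`. -/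
lemma AddChar.exists_hasSum_pow {κ : AddChar ℤ_[p] C} (hκ : Continuous κ)
    (h1 : ‖κ 1 - 1‖ ≤ (p : ℝ)⁻¹ ^ 3) :
    ∃ c : ℕ → C, ∀ y : ℤ_[p], HasSum (fun j : ℕ => c j * algebraMap ℚ_[p] C y ^ j) (κ y) := by
  have hp : (1 : ℝ) < p := by exact_mod_cast (Fact.out : p.Prime).one_lt
  obtain ⟨b, hb⟩ : ∃ b : ℕ → ℕ → C, ∀ k j, b k j =
      ((descPochhammer ℤ k).coeff j : C) / (k.factorial : C) * (κ 1 - 1) ^ k :=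
    ⟨_, fun _ _ => rfl⟩
  refine ⟨fun j => ∑' k, b k j, fun y => ?_⟩
  have hY : ‖algebraMap ℚ_[p] C y‖ ≤ 1 := by
    rw [norm_algebraMap', ← PadicInt.norm_def]
    exact y.norm_le_one
  have hrow (k : ℕ) : HasSum (fun j => b k j * algebraMap ℚ_[p] C y ^ j)
      (algebraMap ℚ_[p] C (Ring.choose y k : ℤ_[p]) * (κ 1 - 1) ^ k) := by
    rw [PadicInt.algebraMap_choose, Finset.sum_mul,
      Finset.sum_congr rfl fun j _ => mul_right_comm _ _ _]
    simp only [← hb]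
    refine hasSum_sum_of_ne_finset_zero fun j hj => ?_
    rw [hb, coeff_eq_zero_of_natDegree_lt (by simpa [descPochhammer_natDegree] using hj)]
    simp
  generalize algebraMap ℚ_[p] C y = Y at hY hrow ⊢
  have hbound (x : ℕ × ℕ) : ‖b x.1 x.2 * Y ^ x.2‖ ≤ (p : ℝ)⁻¹ ^ x.1 * (p : ℝ)⁻¹ ^ x.2 := by
    rw [norm_mul, norm_pow, hb]
    exact (mul_le_of_le_one_right (norm_nonneg _) (pow_le_one₀ (norm_nonneg _) hY)).trans
      (norm_descPochhammer_coeff_div_factorial_mul_pow_le p h1 _ _)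
  have hgeom := summable_geometric_of_lt_one (by positivity) (inv_lt_one_of_one_lt₀ hp)
  have hsum : Summable fun x : ℕ × ℕ => b x.1 x.2 * Y ^ x.2 :=
    .of_norm_bounded (hgeom.mul_of_nonneg hgeom (fun _ => by positivity) fun _ => by positivity)
      hbound
  simpa only [tsum_mul_right] using Summable.hasSum_tsum_swap
    (f := fun k j => b k j * Y ^ j) hsum hrow (AddChar.hasSum_choose_mul_pow hκ y)

end

/-- Every continuous character `χ` of `ℤ_p` with values in `C` is locally
`ℚ_p`-analytic: there exists `n : ℕ` such that for every `a : ℤ_p` there are coefficients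
`c : ℕ → C` with the property that for every `y : ℤ_p` the power series
`∑_k c_k · (ι(p^n·y))^k` converges (`HasSum`) to `χ (a + p^n·y)`, where `ι` is the algebra
map `ℚ_p → C` applied to the image of `p^n·y` in `ℚ_p`. -/
theorem continuous_character_padicInt_locally_analytic
    {p : ℕ} [Fact p.Prime] {C : Type*} [NontriviallyNormedField C]
    [CompleteSpace C] [IsUltrametricDist C] [NormedAlgebra ℚ_[p] C]
    (χ : ℤ_[p] → Cˣ) (hχ : ∀ x y : ℤ_[p], χ (x + y) = χ x * χ y)
    (hcont : Continuous fun x : ℤ_[p] => (χ x : C)) :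
    ∃ n : ℕ, ∀ a : ℤ_[p], ∃ c : ℕ → C, ∀ y : ℤ_[p],
      HasSum (fun k : ℕ =>
          c k * (algebraMap ℚ_[p] C (((p : ℤ_[p]) ^ n * y : ℤ_[p]) : ℚ_[p])) ^ k)
        (χ (a + (p : ℤ_[p]) ^ n * y) : C) := by
  have hp : 0 < (p : ℝ) := by exact_mod_cast (Fact.out : p.Prime).pos
  have hχ0 : χ 0 = 1 := by simpa using hχ 0 0
  have htend : Tendsto (fun n : ℕ => ‖(χ ((p : ℤ_[p]) ^ n) : C) - 1‖) atTop (𝓝 0) := by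
    have hpow : Tendsto (fun n : ℕ => (p : ℤ_[p]) ^ n) atTop (𝓝 0) :=
      tendsto_pow_atTop_nhds_zero_of_norm_lt_one
        (PadicInt.norm_lt_one_iff_dvd _ |>.mpr dvd_rfl)
    simpa [hχ0] using (((hcont.tendsto 0).comp hpow).sub_const 1).norm
  obtain ⟨n, hn⟩ := (htend.eventually_le_const (show 0 < (p : ℝ)⁻¹ ^ 3 by positivity)).exists
  let κ : AddChar ℤ_[p] C :=
    { toFun := fun y => χ ((p : ℤ_[p]) ^ n * y)
      map_zero_eq_one' := by simp [hχ0]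
      map_add_eq_mul' := fun x y => by simp [mul_add, hχ] }
  have hκ : Continuous κ := hcont.comp (continuous_const_mul _)
  obtain ⟨c, hc⟩ := AddChar.exists_hasSum_pow hκ (by simpa [κ] using hn)
  have : CharZero C := Algebra.charZero_of_charZero ℚ_[p] C
  have hpC : (p : C) ≠ 0 := by exact_mod_cast (Fact.out : p.Prime).ne_zero
  refine ⟨n, fun a => ⟨fun k => χ a * (c k / ((p : C) ^ n) ^ k), fun y => ?_⟩⟩
  rw [hχ, Units.val_mul]
  refine ((hc y).mul_left (χ a : C)).congr_fun fun k => ?_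
  simp only [PadicInt.coe_mul, PadicInt.coe_pow, PadicInt.coe_natCast, map_mul, map_pow,
    map_natCast, mul_pow]
  field_simp
end

section
/- Let Γ ≤ O_L^× be a subgroup of finite index in O_L^× with γ^α = 1 for all γ ∈ Γ, let Λ be a nonzero fractional ideal of L, and let t ∈ L with (γ − 1)·x ∈ Λ for every γ ∈ Γ and every x ∈ t + Λ (so t + Λ is Γ-stable and λ ↦ λ^{−α}·N(λ)^{−s} is constant on Γ-orbits). Then there exists a real number s₀ such that for every s ∈ ℂ with Re(s) > s₀, the function induced by λ ↦ λ^{−α}·N(λ)^{−s} on the set of Γ-orbits of (t + Λ) ∖ {0} is summable; i.e., the Eisenstein series E^{0,α}(t, s, Λ, Γ) converges for Re(s) sufficiently large. -/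
open NumberField
open scoped nonZeroDivisors

noncomputable section

variable (L : Type*) [Field L] [NumberField L]

open scoped Classical in
open NumberField.mixedEmbedding in
/-- Every embedding is bounded by the sup norm of the mixed embedding. -/
theorem norm_embedding_le_norm_mixedEmbedding (K : Type*) [Field K] [NumberField K]
    (σ : K →+* ℂ) (x : K) : ‖σ x‖ ≤ ‖mixedEmbedding K x‖ := by
  rw [norm_eq_sup'_normAtPlace, ← InfinitePlace.apply, ← normAtPlace_apply]
  exact Finset.le_sup' (fun w ↦ normAtPlace w (mixedEmbedding K x)) (Finset.mem_univ _)

/-- The absolute norm is the product of the absolute values of the conjugates. -/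
theorem abs_norm_eq_prod_norm_embeddings (K : Type*) [Field K] [NumberField K] (x : K) :
    |(Algebra.norm ℚ x : ℝ)| = ∏ σ : K →+* ℂ, ‖σ x‖ := by
  have h := congrArg (fun z : ℂ ↦ ‖z‖) (Algebra.norm_eq_prod_embeddings ℚ ℂ x)
  simp only [eq_ratCast, norm_prod] at h
  rw [← Fintype.prod_equiv (RingHom.equivRatAlgHom (R := K) (S := ℂ)).symm
    (fun f : K →ₐ[ℚ] ℂ ↦ ‖f x‖) _ (fun _ ↦ rfl), ← h]
  exact (Complex.norm_real _).symm.trans (by push_cast; rfl)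

open scoped Classical in
open NumberField.mixedEmbedding in
/-- Each orbit of the full unit group contains an element whose conjugates are all bounded by
a constant multiple of the geometric mean of their absolute values. -/
theorem exists_unit_norm_mixedEmbedding_le (K : Type*) [Field K] [NumberField K] :
    ∃ C : ℝ, 0 < C ∧ ∀ x : K, x ≠ 0 → ∃ u : (𝓞 K)ˣ,
      ‖mixedEmbedding K (u • x)‖ ≤
        C * |(Algebra.norm ℚ x : ℝ)| ^ (Module.finrank ℚ K : ℝ)⁻¹ := by
  obtain ⟨C, hC, hb⟩ := (fundamentalCone.isBounded_normLeOne K).exists_pos_norm_le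
  refine ⟨C, hC, fun x hx ↦ ?_⟩
  have hN : 0 < |(Algebra.norm ℚ x : ℝ)| := by
    rw [abs_pos]; exact_mod_cast (Algebra.norm_ne_zero_iff.mpr hx)
  have hNx : mixedEmbedding.norm (mixedEmbedding K x) = |(Algebra.norm ℚ x : ℝ)| := by
    rw [mixedEmbedding.norm_eq_norm]; push_cast; rfl
  obtain ⟨u, hu⟩ := fundamentalCone.exists_unit_smul_mem (K := K) (x := mixedEmbedding K x)
    (by rw [hNx]; exact hN.ne')
  refine ⟨u, ?_⟩
  set A := |(Algebra.norm ℚ x : ℝ)| ^ (Module.finrank ℚ K : ℝ)⁻¹ with hA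
  have hApos : 0 < A := Real.rpow_pos_of_pos hN _
  have hAn : A ^ Module.finrank ℚ K = |(Algebra.norm ℚ x : ℝ)| :=
    Real.rpow_inv_natCast_pow hN.le Module.finrank_pos.ne'
  have hmem : A⁻¹ • u • mixedEmbedding K x ∈ fundamentalCone.normLeOne K := by
    refine fundamentalCone.mem_normLeOne.mpr
      ⟨fundamentalCone.smul_mem_of_mem hu (inv_ne_zero hApos.ne'), ?_⟩
    rw [mixedEmbedding.norm_smul, norm_unit_smul, hNx, abs_of_pos (inv_pos.mpr hApos), inv_pow,
      hAn, inv_mul_cancel₀ hN.ne']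
  have h := hb _ hmem
  rw [_root_.norm_smul, Real.norm_of_nonneg (inv_pos.mpr hApos).le, inv_mul_le_iff₀ hApos] at h
  rwa [Units.smul_def, Algebra.smul_def, map_mul, mul_comm C]

theorem abs_norm_unit_smul (K : Type*) [Field K] [NumberField K] (u : (𝓞 K)ˣ) (x : K) :
    |(Algebra.norm ℚ (u • x) : ℝ)| = |(Algebra.norm ℚ x : ℝ)| := by
  have h : |Algebra.norm ℚ ((u : 𝓞 K) : K)| = 1 := NumberField.isUnit_iff_norm.mp u.isUnit
  rw [Units.smul_def, Algebra.smul_def, map_mul, Rat.cast_mul, abs_mul, ← Rat.cast_abs, h,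
    Rat.cast_one, one_mul]

open scoped Classical in
/-- The orbits of a finite index subgroup of the units also contain balanced elements. -/
theorem exists_mem_subgroup_norm_mixedEmbedding_le (K : Type*) [Field K] [NumberField K]
    (Γ : Subgroup (𝓞 K)ˣ) (hΓ : Γ.index ≠ 0) :
    ∃ C : ℝ, 0 < C ∧ ∀ x : K, x ≠ 0 → ∃ γ ∈ Γ,
      ‖mixedEmbedding K (γ • x)‖ ≤
        C * |(Algebra.norm ℚ x : ℝ)| ^ (Module.finrank ℚ K : ℝ)⁻¹ := by
  obtain ⟨C, hC, hu⟩ := exists_unit_norm_mixedEmbedding_le K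
  have : Γ.FiniteIndex := ⟨hΓ⟩
  obtain ⟨D, hD⟩ := Finite.bddAbove_range fun r : (𝓞 K)ˣ ⧸ Γ ↦
    ‖mixedEmbedding K (((r.out)⁻¹ : (𝓞 K)ˣ) : 𝓞 K)‖
  refine ⟨max D 1 * C, by positivity, fun x hx ↦ ?_⟩
  obtain ⟨u, hux⟩ := hu x hx
  refine ⟨(u : (𝓞 K)ˣ ⧸ Γ).out⁻¹ * u, QuotientGroup.eq.mp (Quotient.out_eq' _), ?_⟩
  rw [mul_smul, Units.smul_def (_⁻¹ : (𝓞 K)ˣ), Algebra.smul_def, map_mul, mul_assoc]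
  exact (norm_mul_le _ _).trans (mul_le_mul ((hD ⟨_, rfl⟩).trans (le_max_left _ _)) hux
    (norm_nonneg _) (by positivity))

open scoped Classical in
/-- If all conjugates of `x` are bounded above by a multiple of their geometric mean, they are
also bounded below by a multiple of it. -/
theorem rpow_norm_le_mul_norm_embedding (K : Type*) [Field K] [NumberField K] {C : ℝ}
    {x : K} (hx : x ≠ 0)
    (h : ‖mixedEmbedding K x‖ ≤ C * |(Algebra.norm ℚ x : ℝ)| ^ (Module.finrank ℚ K : ℝ)⁻¹)
    (σ : K →+* ℂ) :
    |(Algebra.norm ℚ x : ℝ)| ^ (Module.finrank ℚ K : ℝ)⁻¹ ≤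
      C ^ (Module.finrank ℚ K - 1) * ‖σ x‖ := by
  have hN : 0 < |(Algebra.norm ℚ x : ℝ)| := by
    rw [abs_pos]; exact_mod_cast (Algebra.norm_ne_zero_iff.mpr hx)
  set A := |(Algebra.norm ℚ x : ℝ)| ^ (Module.finrank ℚ K : ℝ)⁻¹ with hA
  have hApos : 0 < A := Real.rpow_pos_of_pos hN _
  have hAn : A ^ Module.finrank ℚ K = |(Algebra.norm ℚ x : ℝ)| :=
    Real.rpow_inv_natCast_pow hN.le Module.finrank_pos.ne'
  have hcard : (Finset.univ.erase σ).card = Module.finrank ℚ K - 1 := by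
    rw [Finset.card_erase_of_mem (Finset.mem_univ _), Finset.card_univ, Embeddings.card]
  have hprod : ∏ τ ∈ Finset.univ.erase σ, ‖τ x‖ ≤ (C * A) ^ (Module.finrank ℚ K - 1) := by
    rw [← hcard]
    exact (Finset.prod_le_prod (fun _ _ ↦ norm_nonneg _) fun τ _ ↦
      (norm_embedding_le_norm_mixedEmbedding K τ x).trans h).trans_eq (Finset.prod_const _)
  have hsucc : A ^ Module.finrank ℚ K = A * A ^ (Module.finrank ℚ K - 1) := by
    rw [← pow_succ', Nat.sub_add_cancel Module.finrank_pos]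
  refine le_of_mul_le_mul_right ?_ (pow_pos hApos (Module.finrank ℚ K - 1))
  rw [← hsucc, hAn, abs_norm_eq_prod_norm_embeddings,
    ← Finset.mul_prod_erase _ _ (Finset.mem_univ σ)]
  calc _ ≤ ‖σ x‖ * (C * A) ^ (Module.finrank ℚ K - 1) := by gcongr
    _ = _ := by rw [mul_pow]; ring

open scoped Classical in
/-- The summand of a balanced element is bounded by a power of its Minkowski norm. -/
theorem exists_norm_eisSummand_le (K : Type*) [Field K] [NumberField K]
    (Sig : Finset (K →+* ℂ)) (α : (K →+* ℂ) → ℕ) {s : ℂ} (hs : 0 ≤ s.re) {C : ℝ} (hC : 0 < C) :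
    ∃ D : ℝ, ∀ x y : K, y ≠ 0 →
      ‖mixedEmbedding K y‖ ≤ C * |(Algebra.norm ℚ y : ℝ)| ^ (Module.finrank ℚ K : ℝ)⁻¹ →
      |(Algebra.norm ℚ y : ℝ)| = |(Algebra.norm ℚ x : ℝ)| →
      ∏ σ ∈ Sig, σ y ^ α σ = ∏ σ ∈ Sig, σ x ^ α σ →
      ‖eisSummand K Sig α s x‖ ≤
        D * ‖mixedEmbedding K y‖ ^ (-(∑ σ ∈ Sig, α σ + Module.finrank ℚ K * s.re) : ℝ) := by
  set n := Module.finrank ℚ K with hn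
  set a := ∑ σ ∈ Sig, α σ with ha
  refine ⟨(C ^ (n - 1)) ^ a * Real.exp (Real.pi * |s.im|) * C ^ (a + n * s.re : ℝ),
    fun x y hy h hN hP ↦ ?_⟩
  have hNpos : 0 < |(Algebra.norm ℚ y : ℝ)| := by
    rw [abs_pos]; exact_mod_cast (Algebra.norm_ne_zero_iff.mpr hy)
  have hlow := rpow_norm_le_mul_norm_embedding K hy h
  set A := |(Algebra.norm ℚ y : ℝ)| ^ (n : ℝ)⁻¹ with hA
  have hApos : 0 < A := Real.rpow_pos_of_pos hNpos _
  have hn0 : (n : ℝ) ≠ 0 := Nat.cast_ne_zero.mpr Module.finrank_pos.ne'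
  have hNA : |(Algebra.norm ℚ y : ℝ)| ^ (-s.re) = A ^ (-(n * s.re)) := by
    rw [hA, ← Real.rpow_mul hNpos.le]
    congr 1
    field_simp
  have hypos : 0 < ‖mixedEmbedding K y‖ := by
    rw [norm_pos_iff]
    exact (map_ne_zero_iff _ (mixedEmbedding_injective K)).mpr hy
  have hprod : (‖∏ σ ∈ Sig, σ x ^ α σ‖)⁻¹ ≤ (C ^ (n - 1)) ^ a * A ^ (-a : ℝ) := by
    rw [← hP, norm_prod, Real.rpow_neg hApos.le, Real.rpow_natCast, ← div_eq_mul_inv]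
    have hpos : 0 < ∏ σ ∈ Sig, ‖σ y ^ α σ‖ :=
      Finset.prod_pos fun σ _ ↦ norm_pos_iff.mpr (pow_ne_zero _ ((map_ne_zero σ).mpr hy))
    rw [inv_le_iff_one_le_mul₀ hpos, div_mul_eq_mul_div, one_le_div (pow_pos hApos _), ha,
      ← Finset.prod_pow_eq_pow_sum, ← Finset.prod_pow_eq_pow_sum, ← Finset.prod_mul_distrib]
    refine Finset.prod_le_prod (fun _ _ ↦ by positivity) fun σ _ ↦ ?_
    rw [norm_pow, ← mul_pow]
    exact pow_le_pow_left₀ hApos.le (hlow σ) _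
  have hcpow : ‖(Algebra.norm ℚ x : ℂ) ^ (-s)‖ ≤
      Real.exp (Real.pi * |s.im|) * A ^ (-(n * s.re)) := by
    have hnorm : ‖(Algebra.norm ℚ x : ℂ)‖ = |(Algebra.norm ℚ y : ℝ)| := by
      rw [hN, ← Real.norm_eq_abs, ← Complex.norm_real]; push_cast; rfl
    refine (Complex.norm_cpow_le _ _).trans ?_
    rw [hnorm, Complex.neg_re, hNA, div_eq_mul_inv, ← Real.exp_neg, mul_comm]
    gcongr
    rw [Complex.neg_im, mul_neg, neg_neg]
    refine (le_abs_self _).trans ?_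
    rw [abs_mul]
    gcongr
    exact Complex.abs_arg_le_pi _
  have hAy : A ^ (-(a + n * s.re) : ℝ) ≤
      C ^ (a + n * s.re : ℝ) * ‖mixedEmbedding K y‖ ^ (-(a + n * s.re) : ℝ) := by
    have hle : C⁻¹ * ‖mixedEmbedding K y‖ ≤ A := by
      rwa [inv_mul_le_iff₀ hC]
    refine (Real.rpow_le_rpow_of_nonpos (by positivity) hle
      (neg_nonpos.mpr (by positivity))).trans_eq ?_
    rw [Real.mul_rpow (by positivity) hypos.le, Real.inv_rpow hC.le, Real.rpow_neg hC.le, inv_inv]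
  rw [eisSummand, norm_mul, norm_inv]
  calc _ ≤ ((C ^ (n - 1)) ^ a * A ^ (-a : ℝ)) *
        (Real.exp (Real.pi * |s.im|) * A ^ (-(n * s.re))) := by gcongr
    _ = (C ^ (n - 1)) ^ a * Real.exp (Real.pi * |s.im|) * A ^ (-(a + n * s.re) : ℝ) := by
        rw [neg_add, Real.rpow_add hApos]; ring
    _ ≤ _ := by
        rw [mul_assoc (_ * _) (C ^ _)]
        push_cast [ha] at hAy ⊢
        gcongr

/-- Let `L` be totally imaginary, `Γ ≤ 𝓞(L)ˣ` of finite index with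
`γ^α = 1` for all `γ ∈ Γ`, `Λ` a nonzero fractional ideal, and `t ∈ L` with
`(γ − 1)·x ∈ Λ` for all `γ ∈ Γ` and `x ∈ t + Λ`. Then there is `s₀ ∈ ℝ` such that
for every `s ∈ ℂ` with `Re(s) > s₀` the function induced by `λ ↦ λ^{−α}·N(λ)^{−s}` on
the `Γ`-orbits of `(t + Λ) ∖ {0}` is summable: the Eisenstein series
`E^{0,α}(t, s, Λ, Γ)` converges for `Re(s)` sufficiently large. -/
theorem eisenstein_series_summable_of_re_large
    (L : Type*) [Field L] [NumberField L] [IsEmpty (L →+* ℝ)]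
    (Γ : Subgroup ((𝓞 L)ˣ)) (hΓfin : Γ.index ≠ 0)
    (Sig : Finset (L →+* ℂ)) (α : (L →+* ℂ) → ℕ)
    (hΓα : ∀ γ ∈ Γ, (∏ σ ∈ Sig, σ (algebraMap (𝓞 L) L (γ : 𝓞 L)) ^ α σ) = 1)
    (Λ : FractionalIdeal (𝓞 L)⁰ L) (hΛ : Λ ≠ 0) (t : L)
    (hΓΛ : ∀ γ ∈ Γ, ∀ x : L, x - t ∈ Λ →
      ((algebraMap (𝓞 L) L (γ : 𝓞 L)) - 1) * x ∈ Λ) :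
    ∃ s₀ : ℝ, ∀ s : ℂ, s₀ < s.re →
      OrbitSummable L Γ {x : L | x - t ∈ Λ ∧ x ≠ 0} (eisSummand L Sig α s) := by
  classical
  have ht : ∀ γ ∈ Γ, ∀ x : L, x - t ∈ Λ → γ • x - t ∈ Λ := fun γ hγ x hx ↦ by
    have h : _ ∈ Λ := Λ.val.add_mem (hΓΛ γ hγ x hx) hx
    rwa [sub_mul, one_mul, sub_add_sub_cancel, ← Algebra.smul_def, ← Units.smul_def] at h
  have hJ : Λ + FractionalIdeal.spanSingleton (𝓞 L)⁰ t ≠ 0 := fun h ↦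
    hΛ (le_antisymm ((le_add_of_nonneg_right zero_le).trans h.le) zero_le)
  let J : (FractionalIdeal (𝓞 L)⁰ L)ˣ := Units.mk0 _ hJ
  have hmem : ∀ x : L, x - t ∈ Λ → mixedEmbedding L x ∈ mixedEmbedding.idealLattice L J := by
    refine fun x hx ↦ (mixedEmbedding.mem_idealLattice L J).mpr ⟨x, ?_, rfl⟩
    exact (FractionalIdeal.mem_add _ _ _).mpr
      ⟨x - t, hx, t, FractionalIdeal.mem_spanSingleton_self _ _, sub_add_cancel _ _⟩
  obtain ⟨C, hC, hbal⟩ := exists_mem_subgroup_norm_mixedEmbedding_le L Γ hΓfin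
  refine ⟨Module.finrank ℤ (mixedEmbedding.idealLattice L J), fun s hs ↦ ?_⟩
  have hs0 : 0 ≤ s.re := (Nat.cast_nonneg _).trans hs.le
  obtain ⟨D, hD⟩ := exists_norm_eisSummand_le L Sig α hs0 hC
  choose γ hγ hγC using fun q : Quotient (unitOrbitSetoid L Γ {x : L | x - t ∈ Λ ∧ x ≠ 0}) ↦
    hbal (q.out : L) q.out.2.2
  let f : Quotient (unitOrbitSetoid L Γ {x : L | x - t ∈ Λ ∧ x ≠ 0}) →
      mixedEmbedding.idealLattice L J :=
    fun q ↦ ⟨mixedEmbedding L (γ q • (q.out : L)), hmem _ (ht _ (hγ q) _ q.out.2.1)⟩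
  have hf : Function.Injective f := fun q q' h ↦ by
    have h' : γ q • (q.out : L) = γ q' • (q'.out : L) :=
      mixedEmbedding_injective L (congrArg Subtype.val h)
    refine Quotient.out_equiv_out.mp (show (MulAction.orbitRel Γ L).r _ _ from ?_)
    refine ⟨(⟨γ q, hγ q⟩ : Γ)⁻¹ * ⟨γ q', hγ q'⟩, ?_⟩
    change ((γ q)⁻¹ * γ q') • (q'.out : L) = _
    rw [mul_smul, ← h', inv_smul_smul]
  have hr : (-(∑ σ ∈ Sig, α σ + Module.finrank ℚ L * s.re) : ℝ) <
      -Module.finrank ℤ (mixedEmbedding.idealLattice L J) := by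
    have h1 : (1 : ℝ) ≤ Module.finrank ℚ L := Nat.one_le_cast.mpr Module.finrank_pos
    have h2 : (0 : ℝ) ≤ ∑ σ ∈ Sig, (α σ : ℝ) := by positivity
    nlinarith
  refine .of_norm_bounded (((ZLattice.summable_norm_rpow _ _ hr).comp_injective hf).mul_left D)
    fun q ↦ ?_
  refine hD _ (γ q • (q.out : L)) ((smul_ne_zero_iff_ne _).mpr q.out.2.2) ?_
    (abs_norm_unit_smul L _ _) ?_
  · rw [abs_norm_unit_smul]
    exact hγC q
  · simp only [Units.smul_def, Algebra.smul_def, map_mul, mul_pow, Finset.prod_mul_distrib]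
    rw [hΓα _ (hγ q), one_mul]

end
end
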